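/- Let n be a natural number, G the 2×2 matrix [[1,0],[1,1]] over a commutative ring R, and σ a permutation of Fin n. Then the n-th Kronecker power G^{⊗n}, as a 2^n × 2^n matrix indexed by Fin (2^n), satisfies (G^{⊗n})_{π_σ(i), π_σ(j)} = (G^{⊗n})_{i,j} for all i, j ∈ Fin (2^n); equivalently, conjugating G^{⊗n} by the permutation matrix of π_σ leaves it unchanged. -/

import Mathlib

/-- The `k`-th binary digit of the natural number `i`. -/
def bit (k i : ℕ) : ℕ := i / 2 ^ k % 2

/-- The digit permutation `π_σ` on `Fin (2 ^ n)` induced by a permutation `σ` of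
`Fin n`: it sends `i` to the index `j` with `bit (σ k) j = bit k i` for all `k`. -/
def digitPerm (n : ℕ) (σ : Equiv.Perm (Fin n)) (i : Fin (2 ^ n)) : Fin (2 ^ n) :=
  ⟨(∑ k : Fin n, bit k i.val * 2 ^ (σ k : ℕ)) % 2 ^ n, Nat.mod_lt _ (by positivity)⟩

/-- The identification `Fin 2 × Fin (2 ^ n) ≃ Fin (2 ^ (n + 1))` sending `(a, b)`
to the index whose top binary digit is `a` and whose lower `n` digits are `b`. -/
def pow2Equiv (n : ℕ) : Fin 2 × Fin (2 ^ n) ≃ Fin (2 ^ (n + 1)) :=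
  finProdFinEquiv.trans (finCongr (by ring))

/-- The iterated Kronecker product `A (n-1) ⊗ A (n-2) ⊗ ⋯ ⊗ A 0`, defined layer
by layer, viewed as a `2 ^ n × 2 ^ n` matrix indexed by `Fin (2 ^ n)`. -/
def iterKron {R : Type*} [CommRing R] :
    (n : ℕ) → (Fin n → Matrix (Fin 2) (Fin 2) R) →
      Matrix (Fin (2 ^ n)) (Fin (2 ^ n)) R
  | 0, _ => 1
  | n + 1, A =>
      Matrix.reindex (pow2Equiv n) (pow2Equiv n)
        (Matrix.kroneckerMap (· * ·) (A (Fin.last n)) (iterKron n (A ∘ Fin.castSucc)))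

theorem finFunctionFinEquiv_symm_pow2Equiv_last (n : ℕ) (a : Fin 2) (b : Fin (2 ^ n)) :
    finFunctionFinEquiv.symm (pow2Equiv n (a, b)) (Fin.last n) = a := by
  ext
  have ha := a.isLt
  simp only [finFunctionFinEquiv_symm_apply_val, pow2Equiv, Equiv.trans_apply,
    finProdFinEquiv_apply_val, finCongr_apply, Fin.val_cast, Fin.val_last]
  rw [Nat.add_mul_div_left _ _ (by positivity), Nat.div_eq_of_lt b.isLt, zero_add,
    Nat.mod_eq_of_lt ha]

theorem finFunctionFinEquiv_symm_pow2Equiv_castSucc (n : ℕ) (a : Fin 2) (b : Fin (2 ^ n))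
    (k : Fin n) :
    finFunctionFinEquiv.symm (pow2Equiv n (a, b)) k.castSucc =
      finFunctionFinEquiv.symm b k := by
  ext
  simp only [finFunctionFinEquiv_symm_apply_val, pow2Equiv, Equiv.trans_apply,
    finProdFinEquiv_apply_val, finCongr_apply, Fin.val_cast, Fin.val_castSucc]
  obtain ⟨d, hd⟩ := Nat.exists_eq_add_of_lt k.isLt
  have hpow : 2 ^ n * (a : ℕ) = 2 ^ (k : ℕ) * (2 * (2 ^ d * a)) := by
    conv_lhs => rw [hd]
    ring
  rw [hpow, Nat.add_mul_div_left _ _ (by positivity), Nat.add_mul_mod_self_left]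

/-- The entries of an iterated Kronecker product are products over the binary digits. -/
theorem iterKron_apply {R : Type*} [CommRing R] (n : ℕ) (A : Fin n → Matrix (Fin 2) (Fin 2) R)
    (i j : Fin (2 ^ n)) :
    iterKron n A i j =
      ∏ k, A k (finFunctionFinEquiv.symm i k) (finFunctionFinEquiv.symm j k) := by
  induction n with
  | zero =>
    obtain rfl : i = j := Fin.ext (by have := i.isLt; have := j.isLt; omega)
    simp [iterKron]
  | succ n ih =>
    obtain ⟨⟨a, b⟩, rfl⟩ := (pow2Equiv n).surjective i
    obtain ⟨⟨c, d⟩, rfl⟩ := (pow2Equiv n).surjective j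
    simp only [iterKron, Matrix.reindex_apply, Matrix.submatrix_apply, Equiv.symm_apply_apply,
      Matrix.kroneckerMap_apply, ih, Function.comp_apply, Fin.prod_univ_castSucc,
      finFunctionFinEquiv_symm_pow2Equiv_last, finFunctionFinEquiv_symm_pow2Equiv_castSucc]
    exact mul_comm _ _

theorem digitPerm_eq (n : ℕ) (σ : Equiv.Perm (Fin n)) (i : Fin (2 ^ n)) :
    digitPerm n σ i = finFunctionFinEquiv (finFunctionFinEquiv.symm i ∘ σ.symm) := by
  have hsum : ∑ k : Fin n, bit k i.val * 2 ^ (σ k : ℕ) =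
      (finFunctionFinEquiv (finFunctionFinEquiv.symm i ∘ σ.symm) : Fin (2 ^ n)) := by
    rw [finFunctionFinEquiv_apply]
    refine Fintype.sum_equiv σ _ _ fun k => ?_
    simp [bit]
  ext
  simp only [digitPerm, hsum]
  exact Nat.mod_eq_of_lt (Fin.isLt _)

/-- The `n`-th Kronecker power of Arıkan's polarizing kernel `G = [[1,0],[1,1]]`
is invariant under simultaneously permuting its row and column indices by the
digit permutation `π_σ`: `(G^{⊗n}) (π_σ i) (π_σ j) = (G^{⊗n}) i j`. -/
theorem kronPow_digitPerm_invariant {R : Type*} [CommRing R] (n : ℕ)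
    (σ : Equiv.Perm (Fin n)) (i j : Fin (2 ^ n)) :
    iterKron n (fun _ => (!![1, 0; 1, 1] : Matrix (Fin 2) (Fin 2) R))
        (digitPerm n σ i) (digitPerm n σ j) =
      iterKron n (fun _ => (!![1, 0; 1, 1] : Matrix (Fin 2) (Fin 2) R)) i j := by
  simp only [iterKron_apply, digitPerm_eq, Equiv.symm_apply_apply, Function.comp_apply]
  exact Equiv.prod_comp σ.symm fun k => (!![1, 0; 1, 1] : Matrix (Fin 2) (Fin 2) R)
    (finFunctionFinEquiv.symm i k) (finFunctionFinEquiv.symm j k)
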